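/- (Charged components of operators.) Let O be a linear operator on H and, for q ∈ C_p(Ĝ), define its q-component O_q = Σ_{k ∈ C_p(Ĝ)} P(k) O P(k − q). Then: (i) for every cocycle φ ∈ Z^p(G), U(φ) O_q = e^{i⟨q,φ⟩} O_q U(φ); and (ii) if q ∉ B_p(Ĝ) and O_q commutes with U(φ) for every φ ∈ Z^p(G), then O_q = 0. -/

import Mathlib

open Finset

set_option linter.unusedSectionVars false

noncomputable section

/-- The Pontryagin dual `Ĝ = Hom(G, ℝ/2πℤ)` of an abelian group `G`,
where `ℝ/2πℤ` is `Real.Angle = AddCircle (2π)`. -/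
abbrev PDual (G : Type) [AddCommGroup G] : Type := G →+ Real.Angle

/-- The dual of a finite abelian group is finite (hence all the `∑ᶠ` sums over
(subsets of) chain groups with coefficients in `PDual G` below are honest
finite sums). -/
instance PDual.finite (G : Type) [AddCommGroup G] [Fintype G] : Finite (PDual G) := by
  classical
  set n := Fintype.card G with hn
  have hn0 : 0 < n := Fintype.card_pos
  haveI : Fact (0 < 2 * Real.pi) := ⟨by positivity⟩
  have hT0 : Set.Finite {θ : AddCircle (2 * Real.pi) | n • θ = 0} := by
    have hU : Set.Finite
        (⋃ d ∈ Finset.Icc 1 n, {θ : AddCircle (2 * Real.pi) | addOrderOf θ = d}) :=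
      Set.Finite.biUnion (Finset.Icc 1 n).finite_toSet
        (fun d hd => AddCircle.finite_setOf_addOrderOf_eq (2 * Real.pi)
          (by simp only [Finset.coe_Icc, Set.mem_Icc] at hd; exact hd.1))
    refine hU.subset ?_
    intro θ hθ
    have hfin : IsOfFinAddOrder θ := by
      rw [isOfFinAddOrder_iff_nsmul_eq_zero]
      exact ⟨n, hn0, hθ⟩
    have hdvd : addOrderOf θ ∣ n := addOrderOf_dvd_of_nsmul_eq_zero hθ
    have hpos : 0 < addOrderOf θ := hfin.addOrderOf_pos
    refine Set.mem_iUnion₂.mpr ⟨addOrderOf θ, ?_, rfl⟩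
    simp only [Finset.mem_Icc]
    exact ⟨hpos, Nat.le_of_dvd hn0 hdvd⟩
  have hT : Set.Finite {θ : Real.Angle | n • θ = 0} := hT0
  haveI : Finite {θ : Real.Angle | n • θ = 0} := hT.to_subtype
  have hinj : Function.Injective
      (fun (k : G →+ Real.Angle) (g : G) =>
        (⟨k g, by
          show n • k g = 0
          rw [← map_nsmul, card_nsmul_eq_zero, map_zero]⟩ :
          {θ : Real.Angle | n • θ = 0})) := by
    intro k₁ k₂ h
    ext g
    have := congrFun h g
    simpa [Subtype.ext_iff] using this
  exact Finite.of_injective _ hinj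

/-- The well-defined complex exponential `e^{iθ} = cos θ + i sin θ` for `θ ∈ ℝ/2πℤ`. -/
def expA (θ : Real.Angle) : ℂ := Real.Angle.cos θ + Real.Angle.sin θ * Complex.I

variable {G : Type} [AddCommGroup G] [Fintype G]

/-- The pairing `⟨k, φ⟩ = ∑_{σ ∈ Δ} k(σ)(φ(σ))` with values in `ℝ/2πℤ`. -/
def pairing {Δ : Type} [Fintype Δ] (k : Δ → PDual G) (φ : Δ → G) : Real.Angle :=
  ∑ σ, k σ (φ σ)

/-- The boundary map `∂`, `(∂k')(σ) = ∑_τ s(τ,σ) • k'(τ)`; its image is the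
boundary group `B_p(Ĝ)` and its kernel the cycle group `Z_{p+1}(Ĝ)`. -/
def bd {A B : Type} [Fintype A] (s : A → B → ℤ) (k' : A → PDual G) : B → PDual G :=
  fun σ => ∑ τ, s τ σ • k' τ

/-- The coboundary map `δ`, `(δφ)(τ) = ∑_σ s(τ,σ) • φ(σ)`; its kernel is the
cocycle group `Z^p(G)` and its image the coboundary group `B^{p+1}(G)`. -/
def cb {A B : Type} [Fintype B] (s : A → B → ℤ) (φ : B → G) : A → G :=
  fun τ => ∑ σ, s τ σ • φ σ

variable {H : Type} [NormedAddCommGroup H] [InnerProductSpace ℂ H]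
  [FiniteDimensional ℂ H]

/-- The product of a pairwise-commuting finite family of operators. -/
def commProd {ι : Type} [Fintype ι] (f : ι → H →L[ℂ] H)
    (h : ∀ i j, Commute (f i) (f j)) : H →L[ℂ] H :=
  Finset.univ.noncommProd f (fun a _ b _ _ => h a b)

variable {Δp Δp1 : Type} [Fintype Δp] [Fintype Δp1]

/-- `U(φ) = ∏_{σ ∈ Δ^p} U_σ(φ(σ))`. -/
def Uop (U : Δp → G → H →L[ℂ] H)
    (hU : ∀ σ σ' g g', Commute (U σ g) (U σ' g')) (φ : Δp → G) : H →L[ℂ] H :=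
  commProd (fun σ => U σ (φ σ)) fun σ σ' => hU σ σ' _ _

/-- The local factor `|G|⁻¹ ∑_{g ∈ G} e^{−i k(σ)(g)} U_σ(g)` of `P(k)`. -/
def Pfactor (U : Δp → G → H →L[ℂ] H) (k : Δp → PDual G) (σ : Δp) : H →L[ℂ] H :=
  (Fintype.card G : ℂ)⁻¹ • ∑ g : G, expA (-(k σ g)) • U σ g

theorem Pfactor_commute (U : Δp → G → H →L[ℂ] H)
    (hU : ∀ σ σ' g g', Commute (U σ g) (U σ' g')) (k : Δp → PDual G)
    (σ σ' : Δp) : Commute (Pfactor U k σ) (Pfactor U k σ') := by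
  unfold Pfactor
  apply Commute.smul_left
  apply Commute.smul_right
  apply Commute.sum_left
  intro g _
  apply Commute.sum_right
  intro g' _
  exact ((hU σ σ' g g').smul_right _).smul_left _

/-- The projector `P(k) = ∏_{σ ∈ Δ^p} ( |G|⁻¹ ∑_{g ∈ G} e^{−i k(σ)(g)} U_σ(g) )`. -/
def Pop (U : Δp → G → H →L[ℂ] H)
    (hU : ∀ σ σ' g g', Commute (U σ g) (U σ' g')) (k : Δp → PDual G) : H →L[ℂ] H :=
  commProd (Pfactor U k) (Pfactor_commute U hU k)

/-- `Ũ(k') = ∏_{τ ∈ Δ^{p+1}} Ũ_τ(k'(τ))`. -/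
def Utop (Ut : Δp1 → PDual G → H →L[ℂ] H)
    (hUt : ∀ τ τ' ρ ρ', Commute (Ut τ ρ) (Ut τ' ρ')) (k' : Δp1 → PDual G) : H →L[ℂ] H :=
  commProd (fun τ => Ut τ (k' τ)) fun τ τ' => hUt τ τ' _ _

/-- The minimal coupling operator `𝒰 = ∑_{k ∈ B_p(Ĝ)} P(k) Ũ(r(k))`, for a fixed
section `r` of the boundary map. -/
def MC (s : Δp1 → Δp → ℤ) (U : Δp → G → H →L[ℂ] H)
    (hU : ∀ σ σ' g g', Commute (U σ g) (U σ' g'))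
    (Ut : Δp1 → PDual G → H →L[ℂ] H)
    (hUt : ∀ τ τ' ρ ρ', Commute (Ut τ ρ) (Ut τ' ρ'))
    (r : (Δp → PDual G) → (Δp1 → PDual G)) : H →L[ℂ] H :=
  ∑ᶠ k ∈ Set.range (bd (G := G) s), Pop U hU k * Utop Ut hUt (r k)

theorem aux_expA_eq (θ : Real.Angle) : expA θ = (θ.toCircle : ℂ) := by
  rw [Real.Angle.coe_toCircle]; rfl

theorem aux_expA_add (a b : Real.Angle) : expA (a + b) = expA a * expA b := by
  simp [aux_expA_eq]

theorem aux_expA_zero : expA 0 = 1 := by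
  simp [aux_expA_eq]

theorem aux_expA_sum {ι : Type} (t : Finset ι) (f : ι → Real.Angle) :
    expA (∑ i ∈ t, f i) = ∏ i ∈ t, expA (f i) := by
  classical
  induction t using Finset.induction_on with
  | empty => simp [aux_expA_zero]
  | insert a t ha ih => rw [Finset.sum_insert ha, Finset.prod_insert ha, aux_expA_add, ih]

theorem aux_expA_eq_one {θ : Real.Angle} (h : expA θ = 1) : θ = 0 := by
  rw [aux_expA_eq] at h
  rw [← Real.Angle.arg_toCircle θ, h]
  simp

theorem aux_noncommProd_mul {ι : Type} (t : Finset ι) (f g : ι → H →L[ℂ] H)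
    (c : ι → ℂ) (hf : (t : Set ι).Pairwise (Function.onFun Commute f))
    (hg : (t : Set ι).Pairwise (Function.onFun Commute g))
    (hfg : ∀ i j, Commute (f i) (g j)) (h : ∀ i, f i * g i = c i • g i) :
    t.noncommProd f hf * t.noncommProd g hg = (∏ i ∈ t, c i) • t.noncommProd g hg := by
  induction t using Finset.cons_induction_on with
  | empty => simp
  | cons x t hx ih =>
    rw [Finset.noncommProd_cons, Finset.noncommProd_cons, Finset.prod_cons]
    have ih' := ih (hf.mono (by simp)) (hg.mono (by simp))
    have hc : Commute (g x) (t.noncommProd f (hf.mono (by simp))) :=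
      Finset.noncommProd_commute _ _ _ _ (fun y _ => (hfg y x).symm)
    generalize t.noncommProd f _ = F at *
    generalize t.noncommProd g _ = K at *
    calc f x * F * (g x * K) = f x * (F * g x) * K := by simp only [mul_assoc]
      _ = (f x * g x) * (F * K) := by rw [← hc.eq]; simp only [mul_assoc]
      _ = _ := by rw [h, ih', smul_mul_smul_comm]

theorem aux_U_Pfactor (U : Δp → G → H →L[ℂ] H)
    (hUhom : ∀ σ g g', U σ (g + g') = U σ g * U σ g')
    (k : Δp → PDual G) (σ : Δp) (g : G) :
    U σ g * Pfactor U k σ = expA (k σ g) • Pfactor U k σ := by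
  unfold Pfactor
  rw [mul_smul_comm, smul_comm]
  congr 1
  rw [Finset.mul_sum, Finset.smul_sum, ← Equiv.sum_comp (Equiv.addLeft g)
    (fun x => expA (k σ g) • expA (-(k σ x)) • U σ x)]
  refine Finset.sum_congr rfl fun x _ => ?_
  rw [Equiv.coe_addLeft, mul_smul_comm, hUhom, smul_smul, ← aux_expA_add, map_add]
  congr 2
  abel

theorem aux_Uop_Pop_commute (U : Δp → G → H →L[ℂ] H)
    (hU : ∀ σ σ' g g', Commute (U σ g) (U σ' g'))
    (k : Δp → PDual G) (φ : Δp → G) (σ σ' : Δp) :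
    Commute (U σ (φ σ)) (Pfactor U k σ') := by
  unfold Pfactor
  apply Commute.smul_right
  apply Commute.sum_right
  intro g' _
  exact (hU _ _ _ _).smul_right _

theorem aux_Uop_Pop (U : Δp → G → H →L[ℂ] H)
    (hU : ∀ σ σ' g g', Commute (U σ g) (U σ' g'))
    (hUhom : ∀ σ g g', U σ (g + g') = U σ g * U σ g')
    (k : Δp → PDual G) (φ : Δp → G) :
    Uop U hU φ * Pop U hU k = expA (pairing k φ) • Pop U hU k := by
  unfold Uop Pop commProd pairing
  rw [aux_expA_sum]
  exact aux_noncommProd_mul _ _ _ _ _ _ (aux_Uop_Pop_commute U hU k φ)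
    (fun σ => aux_U_Pfactor U hUhom k σ _)

theorem aux_Pop_Uop (U : Δp → G → H →L[ℂ] H)
    (hU : ∀ σ σ' g g', Commute (U σ g) (U σ' g'))
    (hUhom : ∀ σ g g', U σ (g + g') = U σ g * U σ g')
    (k : Δp → PDual G) (φ : Δp → G) :
    Pop U hU k * Uop U hU φ = expA (pairing k φ) • Pop U hU k := by
  rw [← aux_Uop_Pop U hU hUhom]
  have : Commute (Pop U hU k) (Uop U hU φ) := by
    unfold Uop commProd
    apply Finset.noncommProd_commute
    intro σ _
    apply Commute.symm
    unfold Pop commProd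
    apply Finset.noncommProd_commute
    intro σ' _
    exact aux_Uop_Pop_commute U hU k φ σ σ'
  exact this.eq

theorem aux_Uop_neg (U : Δp → G → H →L[ℂ] H)
    (hU : ∀ σ σ' g g', Commute (U σ g) (U σ' g'))
    (hUhom : ∀ σ g g', U σ (g + g') = U σ g * U σ g')
    (hU0 : ∀ σ, U σ 0 = 1) (φ : Δp → G) :
    Uop U hU φ * Uop U hU (-φ) = 1 := by
  have h := Finset.noncommProd_mul_distrib (s := Finset.univ) (fun σ => U σ (φ σ))
    (fun σ => U σ ((-φ) σ)) (fun a _ b _ _ => hU _ _ _ _) (fun a _ b _ _ => hU _ _ _ _)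
    (fun a _ b _ _ => hU _ _ _ _)
  refine Eq.trans h.symm ?_
  rw [Finset.noncommProd_eq_pow_card _ _ _ 1, one_pow]
  intro σ _
  simp [← hUhom, hU0]

theorem aux_pairing_sub (k q : Δp → PDual G) (φ : Δp → G) :
    pairing k φ = pairing q φ + pairing (k - q) φ := by
  simp [pairing, ← Finset.sum_add_distrib]

theorem aux_duality (s : Δp1 → Δp → ℤ) (q : Δp → PDual G)
    (h : ∀ φ : Δp → G, cb s φ = 0 → pairing q φ = 0) :
    q ∈ Set.range (bd (G := G) s) := by
  classical
  let d : (Δp → G) →+ (Δp1 → G) :=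
    { toFun := cb s
      map_zero' := by ext τ; simp [cb]
      map_add' := fun a b => by ext τ; simp [cb, Finset.sum_add_distrib] }
  let f : (Δp → G) →+ Real.Angle :=
    { toFun := pairing q
      map_zero' := by simp [pairing]
      map_add' := fun a b => by simp [pairing, Finset.sum_add_distrib] }
  let f' : (Δp → G) ⧸ d.ker →+ Real.Angle := QuotientAddGroup.lift d.ker f (fun φ hφ => h φ hφ)
  have : Fact (0 < 2 * Real.pi) := ⟨by positivity⟩
  have hB : Module.Baer ℤ Real.Angle :=
    Module.Baer.of_divisible (AddCircle (2 * Real.pi))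
  obtain ⟨F, hF⟩ := hB.extension_property_addMonoidHom (QuotientAddGroup.kerLift d)
    (QuotientAddGroup.kerLift_injective d) f'
  have hF' : ∀ φ, F (cb s φ) = pairing q φ := fun φ => DFunLike.congr_fun hF (φ : _ ⧸ d.ker)
  refine ⟨fun τ => F.comp (AddMonoidHom.single (fun _ => G) τ), ?_⟩
  funext σ
  ext1 g
  have h1 := hF' (Pi.single σ g)
  have h2 : pairing q (Pi.single σ g) = q σ g := by
    unfold pairing
    rw [Finset.sum_eq_single σ]
    · simp
    · intro b _ hb; simp [hb]
    · simp
  have h3 : cb s (Pi.single σ g) = ∑ τ, s τ σ • (Pi.single τ g : Δp1 → G) := by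
    funext τ
    unfold cb
    rw [Finset.sum_apply, Finset.sum_eq_single σ, Finset.sum_eq_single τ]
    · simp
    · intro b _ hb; simp [hb.symm]
    · simp
    · intro b _ hb; simp [hb]
    · simp
  rw [← h2, ← h1, h3, map_sum]
  simp [bd, AddMonoidHom.finsetSum_apply]

/-- **Charged components of operators**: for a linear operator `O` on `H` and
`q ∈ C_p(Ĝ)`, let `O_q = ∑_{k ∈ C_p(Ĝ)} P(k) O P(k − q)`.  Then
(i) for every cocycle `φ ∈ Z^p(G)`, `U(φ) O_q = e^{i⟨q,φ⟩} O_q U(φ)`; and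
(ii) if `q ∉ B_p(Ĝ)` and `O_q` commutes with `U(φ)` for every cocycle `φ`,
then `O_q = 0`. -/
theorem charged_components
    (s : Δp1 → Δp → ℤ)
    (U : Δp → G → H →L[ℂ] H)
    (hU : ∀ σ σ' g g', Commute (U σ g) (U σ' g'))
    (hUhom : ∀ σ g g', U σ (g + g') = U σ g * U σ g')
    (hU0 : ∀ σ, U σ 0 = 1)
    (hUunit : ∀ σ g, star (U σ g) * U σ g = 1 ∧ U σ g * star (U σ g) = 1)
    (O : H →L[ℂ] H) (q : Δp → PDual G) :
    (∀ φ : Δp → G, cb s φ = 0 →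
      Uop U hU φ * (∑ᶠ k : Δp → PDual G, Pop U hU k * O * Pop U hU (k - q))
        = expA (pairing q φ) •
            ((∑ᶠ k : Δp → PDual G, Pop U hU k * O * Pop U hU (k - q)) * Uop U hU φ)) ∧
    (q ∉ Set.range (bd (G := G) s) →
      (∀ φ : Δp → G, cb s φ = 0 →
        (∑ᶠ k : Δp → PDual G, Pop U hU k * O * Pop U hU (k - q)) * Uop U hU φ
          = Uop U hU φ * (∑ᶠ k : Δp → PDual G, Pop U hU k * O * Pop U hU (k - q))) →
      (∑ᶠ k : Δp → PDual G, Pop U hU k * O * Pop U hU (k - q)) = 0) := by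
  have key : ∀ φ : Δp → G,
      Uop U hU φ * (∑ᶠ k : Δp → PDual G, Pop U hU k * O * Pop U hU (k - q))
        = expA (pairing q φ) •
            ((∑ᶠ k : Δp → PDual G, Pop U hU k * O * Pop U hU (k - q)) * Uop U hU φ) := by
    intro φ
    haveI : Fintype (Δp → PDual G) := Fintype.ofFinite _
    rw [finsum_eq_sum_of_fintype, Finset.mul_sum, Finset.sum_mul, Finset.smul_sum]
    refine Finset.sum_congr rfl fun k _ => ?_
    rw [← mul_assoc, ← mul_assoc, aux_Uop_Pop U hU hUhom, mul_assoc _ _ (Uop U hU φ),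
      aux_Pop_Uop U hU hUhom, mul_smul_comm, smul_mul_assoc, smul_mul_assoc, smul_smul,
      ← aux_expA_add, ← aux_pairing_sub]
  refine ⟨fun φ _ => key φ, fun hq hcomm => ?_⟩
  by_contra hne
  refine hq (aux_duality s q fun φ hφ => ?_)
  by_contra hp
  apply hne
  have h1 := key φ
  rw [← hcomm φ hφ] at h1
  generalize (∑ᶠ k : Δp → PDual G, Pop U hU k * O * Pop U hU (k - q)) = X at *
  have h2 : (1 - expA (pairing q φ)) • (X * Uop U hU φ) = 0 := by
    rw [sub_smul, one_smul, ← h1, sub_self]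
  rcases smul_eq_zero.mp h2 with h3 | h3
  · exact absurd (aux_expA_eq_one (sub_eq_zero.mp h3).symm) hp
  · calc X = X * Uop U hU φ * Uop U hU (-φ) := by
          rw [mul_assoc, aux_Uop_neg U hU hUhom hU0, mul_one]
      _ = 0 := by rw [h3, zero_mul]
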